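/- arXiv:1206.3043 — 11 statements merged into one kernel-verified Lean document; each statement's English description precedes it below -/
import Mathlib

section
/- Consider the metapopulation ODE system for chikungunya on n nodes. If all initial values at time t = 0 are nonnegative (i.e. S_{ij}(0) ≥ 0, I_{ij}(0) ≥ 0, R_{ij}(0) ≥ 0 for all i, j, and Sm_i(0) ≥ 0, Im_i(0) ≥ 0 for all i), then the solution remains nonnegative for all t ≥ 0: S_{ij}(t) ≥ 0, I_{ij}(t) ≥ 0, R_{ij}(t) ≥ 0, Sm_i(t) ≥ 0, Im_i(t) ≥ 0 for every t ≥ 0 in the interval of existence. -/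
/-- `f` is bounded below by `-C δ` whenever all the components of `x` are at least `-δ`. -/
def QPos {ι : Type} (T : ℝ) (x : ι → ℝ → ℝ) (f : ℝ → ℝ) : Prop :=
  ∃ C : ℝ, 0 ≤ C ∧ ∀ t ∈ Set.Icc (0:ℝ) T, ∀ δ : ℝ, 0 < δ → (∀ l, -δ ≤ x l t) → -(C * δ) ≤ f t

theorem QPos.of_nonneg {ι : Type} {T : ℝ} {x : ι → ℝ → ℝ} {f : ℝ → ℝ}
    (h : ∀ t ∈ Set.Icc (0:ℝ) T, 0 ≤ f t) : QPos T x f :=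
  ⟨0, le_refl _, fun t ht δ _ _ => by simpa using h t ht⟩

theorem QPos.comp {ι : Type} {T : ℝ} {x : ι → ℝ → ℝ} (l : ι) : QPos T x (x l) :=
  ⟨1, zero_le_one, fun t _ δ _ h => by simpa using h l⟩

theorem QPos.add {ι : Type} {T : ℝ} {x : ι → ℝ → ℝ} {f g : ℝ → ℝ}
    (hf : QPos T x f) (hg : QPos T x g) : QPos T x (fun t => f t + g t) := by
  obtain ⟨C, hC, h⟩ := hf
  obtain ⟨D, hD, h'⟩ := hg
  refine ⟨C + D, by positivity, fun t ht δ hδ hx => ?_⟩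
  have := h t ht δ hδ hx
  have := h' t ht δ hδ hx
  linarith

theorem QPos.cmul {ι : Type} {T : ℝ} {x : ι → ℝ → ℝ} {f : ℝ → ℝ} {c : ℝ} (hc : 0 ≤ c)
    (hf : QPos T x f) : QPos T x (fun t => c * f t) := by
  obtain ⟨C, hC, h⟩ := hf
  refine ⟨c * C, by positivity, fun t ht δ hδ hx => ?_⟩
  have := mul_le_mul_of_nonneg_left (h t ht δ hδ hx) hc
  linarith

theorem QPos.sum {ι κ : Type} {T : ℝ} {x : ι → ℝ → ℝ} {f : κ → ℝ → ℝ} (s : Finset κ)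
    (hf : ∀ k, QPos T x (f k)) : QPos T x (fun t => ∑ k ∈ s, f k t) := by
  classical
  induction s using Finset.induction_on with
  | empty => exact QPos.of_nonneg (by simp)
  | insert a s ha ih =>
    simp only [Finset.sum_insert ha]
    exact (hf a).add ih

theorem QPos.mul {ι : Type} {T : ℝ} {x : ι → ℝ → ℝ} {f g : ℝ → ℝ}
    (hf : QPos T x f) (hg : QPos T x g) (cf : ContinuousOn f (Set.Icc 0 T))
    (cg : ContinuousOn g (Set.Icc 0 T)) : QPos T x (fun t => f t * g t) := by
  obtain ⟨C, hC, h⟩ := hf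
  obtain ⟨D, hD, h'⟩ := hg
  obtain ⟨M, hM⟩ := isCompact_Icc.exists_bound_of_continuousOn cf
  obtain ⟨N, hN⟩ := isCompact_Icc.exists_bound_of_continuousOn cg
  refine ⟨|N| * C + |M| * D, by positivity, fun t ht δ hδ hx => ?_⟩
  have h1 := h t ht δ hδ hx
  have h2 := h' t ht δ hδ hx
  have h3 := (hM t ht).trans (le_abs_self M)
  have h4 := (hN t ht).trans (le_abs_self N)
  rw [Real.norm_eq_abs] at h3 h4
  have p1 : 0 ≤ C * δ := by positivity
  have p2 : 0 ≤ D * δ := by positivity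
  have q1 : 0 ≤ |N| * (C * δ) := by positivity
  have q2 : 0 ≤ |M| * (D * δ) := by positivity
  have e : -((|N| * C + |M| * D) * δ) = -(|N| * (C * δ)) - |M| * (D * δ) := by ring
  rw [e]
  have a3 := abs_le.mp h3
  have a4 := abs_le.mp h4
  rcases le_total 0 (f t) with hf0 | hf0 <;> rcases le_total 0 (g t) with hg0 | hg0
  · nlinarith [mul_nonneg hf0 hg0]
  · nlinarith [mul_le_mul a3.2 (neg_le.mp h2) (by linarith) (abs_nonneg M)]
  · nlinarith [mul_le_mul a4.2 (neg_le.mp h1) (by linarith) (abs_nonneg N)]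
  · nlinarith [mul_nonneg_of_nonpos_of_nonpos hf0 hg0]

theorem quasipositive_nonneg {ι : Type} [Fintype ι] {T : ℝ} (hT : 0 ≤ T)
    (x P a : ι → ℝ → ℝ)
    (hd : ∀ k, ∀ t ∈ Set.Icc (0:ℝ) T, HasDerivAt (x k) (P k t - a k t * x k t) t)
    (hP : ∀ k, QPos T x (P k)) (ha : ∀ k, ContinuousOn (a k) (Set.Icc 0 T))
    (h0 : ∀ k, 0 ≤ x k 0) (k : ι) : 0 ≤ x k T := by
  choose C hC hPC using hP
  choose A hA using fun k => isCompact_Icc.exists_bound_of_continuousOn (ha k)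
  set K : ℝ := ∑ k, (C k + |A k|) + 1 with hK
  have hKk : ∀ k, C k + |A k| + 1 ≤ K := fun k => by
    have := Finset.single_le_sum (f := fun k => C k + |A k|)
      (fun i _ => add_nonneg (hC i) (abs_nonneg _)) (Finset.mem_univ k)
    linarith
  have key : ∀ ε : ℝ, 0 < ε → ∀ t ∈ Set.Icc (0:ℝ) T, ∀ k, 0 < x k t + ε * Real.exp (K * t) := by
    intro ε hε
    by_contra! hcon
    let B : Set ℝ := ⋃ k, {t ∈ Set.Icc (0:ℝ) T | x k t + ε * Real.exp (K * t) ≤ 0}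
    have hyc : ∀ k, ContinuousOn (fun t => x k t + ε * Real.exp (K * t)) (Set.Icc 0 T) := fun k =>
      ContinuousOn.add (fun t ht => (hd k t ht).continuousAt.continuousWithinAt)
        (by fun_prop)
    have hBc : IsClosed B := isClosed_iUnion_of_finite fun k =>
      (hyc k).preimage_isClosed_of_isClosed isClosed_Icc isClosed_Iic
    have hBsub : B ⊆ Set.Icc 0 T := Set.iUnion_subset fun k t ht => ht.1
    have hBcomp : IsCompact B := isCompact_Icc.of_isClosed_subset hBc hBsub
    have hBne : B.Nonempty := by
      obtain ⟨t, ht, k, hk⟩ := hcon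
      exact ⟨t, Set.mem_iUnion.2 ⟨k, ht, hk⟩⟩
    obtain ⟨s, hsB, hsmin⟩ := hBcomp.exists_isLeast hBne
    obtain ⟨k, hs, hk⟩ := Set.mem_iUnion.1 hsB
    have hbefore : ∀ t, 0 ≤ t → t < s → ∀ l, 0 < x l t + ε * Real.exp (K * t) := by
      intro t ht hts l
      by_contra! hl
      have : s ≤ t := hsmin (Set.mem_iUnion.2 ⟨l, ⟨ht, hts.le.trans hs.2⟩, hl⟩)
      linarith
    have hspos : 0 < s := by
      rcases hs.1.lt_or_eq with h | h
      · exact h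
      · subst h
        have := h0 k
        simp at hk
        linarith
    have hcont : ∀ l, ContinuousAt (fun t => x l t + ε * Real.exp (K * t)) s := fun l =>
      (hd l s hs).continuousAt.add (by fun_prop)
    have hev : ∀ᶠ t in nhdsWithin s (Set.Iio s), 0 ≤ t ∧ t < s := by
      filter_upwards [Ioo_mem_nhdsLT hspos] with t ht using ⟨ht.1.le, ht.2⟩
    have hnn : ∀ l, 0 ≤ x l s + ε * Real.exp (K * s) := fun l =>
      ge_of_tendsto ((hcont l).tendsto.mono_left nhdsWithin_le_nhds)
        (hev.mono fun t ht => (hbefore t ht.1 ht.2 l).le)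
    set δ := ε * Real.exp (K * s) with hδ
    have hδpos : 0 < δ := by positivity
    have hxk : x k s = -δ := by linarith [hnn k]
    have hPk := hPC k s hs δ hδpos (fun l => by linarith [hnn l])
    have hak := (hA k s hs).trans (le_abs_self _)
    rw [Real.norm_eq_abs] at hak
    have hak' := (abs_le.mp hak).1
    have hder : HasDerivAt (fun t => x k t + ε * Real.exp (K * t))
        (P k s - a k s * x k s + K * δ) s := by
      have h1 : HasDerivAt (fun t : ℝ => K * t) K s := by simpa using (hasDerivAt_id s).const_mul K
      have h2 := (hd k s hs).add ((h1.exp).const_mul ε)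
      exact h2.congr_deriv (by rw [hδ]; ring)
    have hpos : 0 < P k s - a k s * x k s + K * δ := by
      rw [hxk]
      nlinarith [mul_le_mul_of_nonneg_right (hKk k) hδpos.le,
        mul_le_mul_of_nonneg_right hak' hδpos.le]
    have hsub : Set.Iio s ⊆ {s}ᶜ := fun t ht => ne_of_lt ht
    have hsl := (hasDerivAt_iff_tendsto_slope.1 hder).mono_left (nhdsWithin_mono s hsub)
    obtain ⟨t, ht1, ht2, ht3⟩ := ((hsl.eventually (lt_mem_nhds hpos)).and hev).exists
    have hb := hbefore t ht2 ht3 k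
    rw [slope_def_field] at ht1
    have h5 : x k s + ε * Real.exp (K * s) = 0 := by rw [hxk]; ring
    simp only [h5, sub_zero] at ht1
    have := div_neg_of_pos_of_neg hb (sub_neg.2 ht3)
    linarith
  by_contra! hneg
  have hE : 0 < Real.exp (K * T) := Real.exp_pos _
  have := key (-(x k T) / (2 * Real.exp (K * T))) (by apply div_pos <;> linarith) T ⟨hT, le_refl _⟩ k
  have e : -(x k T) / (2 * Real.exp (K * T)) * Real.exp (K * T) = -(x k T) / 2 := by field_simp
  rw [e] at this
  linarith


theorem metapop_nonneg_invariant {n : ℕ} (hn : 1 ≤ n)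
    (dH γH dm sL : ℝ) (hdH : 0 < dH) (hγH : 0 < γH) (hdm : 0 < dm) (hsL : 0 ≤ sL)
    (βH βm Lc g : Fin n → ℝ)
    (hβH : ∀ i, 0 < βH i) (hβm : ∀ i, 0 < βm i)
    (hLc : ∀ i, 0 ≤ Lc i) (hg : ∀ i, 0 ≤ g i)
    (m r : Fin n → Fin n → ℝ)
    (hm : ∀ j i, 0 ≤ m j i) (hmii : ∀ i, m i i = 0)
    (hr : ∀ i j, 0 ≤ r i j) (hrii : ∀ i, r i i = 0)
    (S I R : Fin n → Fin n → ℝ → ℝ) (Sm Im : Fin n → ℝ → ℝ)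
    (Np Nr : Fin n → ℝ → ℝ)
    (hNp : ∀ i t, Np i t = ∑ j, (S j i t + I j i t + R j i t))
    (hNr : ∀ i t, Nr i t = ∑ j, (S i j t + I i j t + R i j t))
    (hNppos : ∀ i t, 0 ≤ t → 0 < Np i t)
    (hderivS : ∀ (i : Fin n) (t : ℝ), 0 ≤ t →
      HasDerivAt (S i i)
        (dH * (Nr i t - S i i t) - g i * S i i t + (∑ k, r i k * S i k t)
          - βH i * (Im i t / Np i t) * S i i t) t)
    (hderivSoff : ∀ (i j : Fin n), j ≠ i → ∀ (t : ℝ), 0 ≤ t →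
      HasDerivAt (S i j)
        (g i * m j i * S i i t - dH * S i j t - r i j * S i j t
          - βH j * (Im j t / Np j t) * S i j t) t)
    (hderivI : ∀ (i : Fin n) (t : ℝ), 0 ≤ t →
      HasDerivAt (I i i)
        (-(dH + γH + g i) * I i i t + (∑ k, r i k * I i k t)
          + βH i * (Im i t / Np i t) * S i i t) t)
    (hderivIoff : ∀ (i j : Fin n), j ≠ i → ∀ (t : ℝ), 0 ≤ t →
      HasDerivAt (I i j)
        (g i * m j i * I i i t - (dH + γH + r i j) * I i j t
          + βH j * (Im j t / Np j t) * S i j t) t)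
    (hderivR : ∀ (i : Fin n) (t : ℝ), 0 ≤ t →
      HasDerivAt (R i i)
        (γH * I i i t - (dH + g i) * R i i t + (∑ k, r i k * R i k t)) t)
    (hderivRoff : ∀ (i j : Fin n), j ≠ i → ∀ (t : ℝ), 0 ≤ t →
      HasDerivAt (R i j)
        (g i * m j i * R i i t + γH * I i j t - (dH + r i j) * R i j t) t)
    (hderivSm : ∀ (i : Fin n) (t : ℝ), 0 ≤ t →
      HasDerivAt (Sm i)
        (sL * Lc i - dm * Sm i t - βm i * (Sm i t / Np i t) * ∑ k, I k i t) t)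
    (hderivIm : ∀ (i : Fin n) (t : ℝ), 0 ≤ t →
      HasDerivAt (Im i)
        (βm i * (Sm i t / Np i t) * (∑ k, I k i t) - dm * Im i t) t)
    (hS0 : ∀ i j, 0 ≤ S i j 0) (hI0 : ∀ i j, 0 ≤ I i j 0) (hR0 : ∀ i j, 0 ≤ R i j 0)
    (hSm0 : ∀ i, 0 ≤ Sm i 0) (hIm0 : ∀ i, 0 ≤ Im i 0) :
    ∀ t : ℝ, 0 ≤ t →
      (∀ i j, 0 ≤ S i j t) ∧ (∀ i j, 0 ≤ I i j t) ∧ (∀ i j, 0 ≤ R i j t) ∧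
      (∀ i, 0 ≤ Sm i t) ∧ (∀ i, 0 ≤ Im i t) := by
  intro T hT
  have cS : ∀ i j, ContinuousOn (S i j) (Set.Icc 0 T) := fun i j t ht => by
    by_cases h : j = i
    · subst h; exact (hderivS _ t ht.1).continuousAt.continuousWithinAt
    · exact (hderivSoff i j h t ht.1).continuousAt.continuousWithinAt
  have cI : ∀ i j, ContinuousOn (I i j) (Set.Icc 0 T) := fun i j t ht => by
    by_cases h : j = i
    · subst h; exact (hderivI _ t ht.1).continuousAt.continuousWithinAt
    · exact (hderivIoff i j h t ht.1).continuousAt.continuousWithinAt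
  have cR : ∀ i j, ContinuousOn (R i j) (Set.Icc 0 T) := fun i j t ht => by
    by_cases h : j = i
    · subst h; exact (hderivR _ t ht.1).continuousAt.continuousWithinAt
    · exact (hderivRoff i j h t ht.1).continuousAt.continuousWithinAt
  have cSm : ∀ i, ContinuousOn (Sm i) (Set.Icc 0 T) := fun i t ht =>
    (hderivSm i t ht.1).continuousAt.continuousWithinAt
  have cIm : ∀ i, ContinuousOn (Im i) (Set.Icc 0 T) := fun i t ht =>
    (hderivIm i t ht.1).continuousAt.continuousWithinAt
  have cNp : ∀ i, ContinuousOn (Np i) (Set.Icc 0 T) := fun i => by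
    rw [show Np i = fun t => ∑ j, (S j i t + I j i t + R j i t) from funext (hNp i)]
    exact continuousOn_finsetSum _ fun j _ => ((cS j i).add (cI j i)).add (cR j i)
  have cw : ∀ i, ContinuousOn (fun t => (Np i t)⁻¹) (Set.Icc 0 T) := fun i =>
    (cNp i).inv₀ fun t ht => (hNppos i t ht.1).ne'
  have cIs : ∀ i, ContinuousOn (fun t => ∑ k, I k i t) (Set.Icc 0 T) := fun i =>
    continuousOn_finsetSum _ fun j _ => cI j i
  have cF : ∀ i, ContinuousOn (fun t => βH i * (Im i t * (Np i t)⁻¹)) (Set.Icc 0 T) := fun i =>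
    continuousOn_const.mul ((cIm i).mul (cw i))
  let x : (Fin n × Fin n) ⊕ (Fin n × Fin n) ⊕ (Fin n × Fin n) ⊕ Fin n ⊕ Fin n → ℝ → ℝ :=
    Sum.elim (fun p => S p.1 p.2) (Sum.elim (fun p => I p.1 p.2) (Sum.elim (fun p => R p.1 p.2)
      (Sum.elim Sm Im)))
  have qS : ∀ i j, QPos T x (S i j) := fun i j => QPos.comp (x := x) (Sum.inl (i, j))
  have qI : ∀ i j, QPos T x (I i j) := fun i j => QPos.comp (x := x) (Sum.inr (Sum.inl (i, j)))
  have qR : ∀ i j, QPos T x (R i j) := fun i j =>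
    QPos.comp (x := x) (Sum.inr (Sum.inr (Sum.inl (i, j))))
  have qSm : ∀ i, QPos T x (Sm i) := fun i =>
    QPos.comp (x := x) (Sum.inr (Sum.inr (Sum.inr (Sum.inl i))))
  have qIm : ∀ i, QPos T x (Im i) := fun i =>
    QPos.comp (x := x) (Sum.inr (Sum.inr (Sum.inr (Sum.inr i))))
  have qw : ∀ i, QPos T x (fun t => (Np i t)⁻¹) := fun i =>
    QPos.of_nonneg fun t ht => (inv_pos.2 (hNppos i t ht.1)).le
  have qNr : ∀ i, QPos T x (Nr i) := fun i => by
    rw [show Nr i = fun t => ∑ j, (S i j t + I i j t + R i j t) from funext (hNr i)]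
    exact QPos.sum _ fun j => ((qS i j).add (qI i j)).add (qR i j)
  have qF : ∀ i, QPos T x (fun t => βH i * (Im i t * (Np i t)⁻¹)) := fun i =>
    ((qIm i).mul (qw i) (cIm i) (cw i)).cmul (hβH i).le
  have qFS : ∀ i j, QPos T x (fun t => βH j * (Im j t * (Np j t)⁻¹) * S i j t) := fun i j =>
    (qF j).mul (qS i j) (cF j) (cS i j)
  have qM : ∀ i, QPos T x (fun t => βm i * (Sm i t * (Np i t)⁻¹ * ∑ k, I k i t)) := fun i =>
    (((qSm i).mul (qw i) (cSm i) (cw i)).mul (QPos.sum _ fun k => qI k i)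
      ((cSm i).mul (cw i)) (cIs i)).cmul (hβm i).le
  have hex : ∀ k, ∃ P a : ℝ → ℝ, QPos T x P ∧ ContinuousOn a (Set.Icc 0 T) ∧
      ∀ t ∈ Set.Icc (0:ℝ) T, HasDerivAt (x k) (P t - a t * x k t) t := by
    rintro (⟨i, j⟩ | ⟨i, j⟩ | ⟨i, j⟩ | i | i)
    · by_cases h : j = i
      · subst h
        refine ⟨fun t => dH * Nr j t + ∑ k, r j k * S j k t,
          fun t => (dH + g j) + βH j * (Im j t * (Np j t)⁻¹),
          ((qNr j).cmul hdH.le).add (QPos.sum _ fun k => (qS j k).cmul (hr j k)),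
          continuousOn_const.add (cF j), fun t ht => ?_⟩
        refine HasDerivAt.congr_deriv (hderivS j t ht.1) ?_
        change _ = _ - _ * S j j t
        simp only [div_eq_mul_inv]; ring
      · refine ⟨fun t => g i * m j i * S i i t,
          fun t => (dH + r i j) + βH j * (Im j t * (Np j t)⁻¹),
          (qS i i).cmul (mul_nonneg (hg i) (hm j i)),
          continuousOn_const.add (cF j), fun t ht => ?_⟩
        refine HasDerivAt.congr_deriv (hderivSoff i j h t ht.1) ?_
        change _ = _ - _ * S i j t
        simp only [div_eq_mul_inv]; ring
    · by_cases h : j = i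
      · subst h
        refine ⟨fun t => (∑ k, r j k * I j k t) + βH j * (Im j t * (Np j t)⁻¹) * S j j t,
          fun t => dH + γH + g j,
          (QPos.sum _ fun k => (qI j k).cmul (hr j k)).add (qFS j j),
          continuousOn_const, fun t ht => ?_⟩
        refine HasDerivAt.congr_deriv (hderivI j t ht.1) ?_
        change _ = _ - _ * I j j t
        simp only [div_eq_mul_inv]; ring
      · refine ⟨fun t => g i * m j i * I i i t + βH j * (Im j t * (Np j t)⁻¹) * S i j t,
          fun t => dH + γH + r i j,
          ((qI i i).cmul (mul_nonneg (hg i) (hm j i))).add (qFS i j),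
          continuousOn_const, fun t ht => ?_⟩
        refine HasDerivAt.congr_deriv (hderivIoff i j h t ht.1) ?_
        change _ = _ - _ * I i j t
        simp only [div_eq_mul_inv]; ring
    · by_cases h : j = i
      · subst h
        refine ⟨fun t => γH * I j j t + ∑ k, r j k * R j k t,
          fun t => dH + g j,
          ((qI j j).cmul hγH.le).add (QPos.sum _ fun k => (qR j k).cmul (hr j k)),
          continuousOn_const, fun t ht => ?_⟩
        refine HasDerivAt.congr_deriv (hderivR j t ht.1) ?_
        change _ = _ - _ * R j j t
        ring
      · refine ⟨fun t => g i * m j i * R i i t + γH * I i j t,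
          fun t => dH + r i j,
          ((qR i i).cmul (mul_nonneg (hg i) (hm j i))).add ((qI i j).cmul hγH.le),
          continuousOn_const, fun t ht => ?_⟩
        refine HasDerivAt.congr_deriv (hderivRoff i j h t ht.1) ?_
        change _ = _ - _ * R i j t
        ring
    · refine ⟨fun _ => sL * Lc i, fun t => dm + βm i * ((Np i t)⁻¹ * ∑ k, I k i t),
        QPos.of_nonneg fun _ _ => mul_nonneg hsL (hLc i),
        continuousOn_const.add (continuousOn_const.mul ((cw i).mul (cIs i))), fun t ht => ?_⟩
      refine HasDerivAt.congr_deriv (hderivSm i t ht.1) ?_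
      change _ = _ - _ * Sm i t
      simp only [div_eq_mul_inv]; ring
    · refine ⟨fun t => βm i * (Sm i t * (Np i t)⁻¹ * ∑ k, I k i t), fun _ => dm,
        qM i, continuousOn_const, fun t ht => ?_⟩
      refine HasDerivAt.congr_deriv (hderivIm i t ht.1) ?_
      change _ = _ - _ * Im i t
      simp only [div_eq_mul_inv]; ring
  choose P a hP ha hd using hex
  have h0 : ∀ k, 0 ≤ x k 0 := by
    rintro (⟨i, j⟩ | ⟨i, j⟩ | ⟨i, j⟩ | i | i)
    exacts [hS0 i j, hI0 i j, hR0 i j, hSm0 i, hIm0 i]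
  have main := quasipositive_nonneg hT x P a hd hP ha h0
  exact ⟨fun i j => main (Sum.inl (i, j)), fun i j => main (Sum.inr (Sum.inl (i, j))),
    fun i j => main (Sum.inr (Sum.inr (Sum.inl (i, j)))),
    fun i => main (Sum.inr (Sum.inr (Sum.inr (Sum.inl i)))),
    fun i => main (Sum.inr (Sum.inr (Sum.inr (Sum.inr i))))⟩
end

section
/- Consider the metapopulation ODE system for chikungunya on n nodes with a nonnegative solution on [0, ∞) such that Nr_i(0) > 0 for every node i. Then for every t > 0 one has S_{ii}(t) > 0 for all i, and moreover S_{ij}(t) > 0 for all t > 0 whenever g_i m_{ji} > 0. -/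
theorem aux_pos_of_deriv_ge (f f' : ℝ → ℝ) (c : ℝ)
    (hf : ∀ t, 0 ≤ t → HasDerivAt f (f' t) t)
    (hb : ∀ t, 0 ≤ t → -c * f t ≤ f' t) (h0 : 0 < f 0) (t : ℝ) (ht : 0 ≤ t) : 0 < f t := by
  have hd : ∀ x, 0 ≤ x → HasDerivAt (fun x => f x * Real.exp (c * x))
      (f' x * Real.exp (c * x) + f x * (Real.exp (c * x) * (c * 1))) x := by
    intro x hx
    exact (hf x hx).mul (((hasDerivAt_id x).const_mul c).exp)
  have hmono : MonotoneOn (fun x => f x * Real.exp (c * x)) (Set.Ici 0) := by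
    apply monotoneOn_of_deriv_nonneg (convex_Ici 0)
    · intro x hx
      exact (hd x hx).continuousAt.continuousWithinAt
    · intro x hx
      rw [interior_Ici] at hx
      exact (hd x (le_of_lt hx)).differentiableAt.differentiableWithinAt
    · intro x hx
      rw [interior_Ici] at hx
      rw [(hd x (le_of_lt hx)).deriv]
      have h1 := hb x (le_of_lt hx)
      have h2 : f' x * Real.exp (c * x) + f x * (Real.exp (c * x) * (c * 1))
          = (f' x + c * f x) * Real.exp (c * x) := by ring
      rw [h2]
      exact mul_nonneg (by linarith) (Real.exp_pos _).le
  have h := hmono (Set.self_mem_Ici) (Set.mem_Ici.2 ht) ht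
  simp only [mul_zero, Real.exp_zero, mul_one] at h
  exact pos_of_mul_pos_left (lt_of_lt_of_le h0 h) (Real.exp_pos _).le

theorem aux_deriv_zero (f : ℝ → ℝ) (d t : ℝ) (ht : 0 < t) (hf : HasDerivAt f d t)
    (hn : ∀ x, 0 ≤ x → 0 ≤ f x) (h0 : f t = 0) : d = 0 := by
  have hmin : IsLocalMin f t := by
    filter_upwards [lt_mem_nhds ht] with x hx
    rw [h0]
    exact hn x (le_of_lt hx)
  exact hmin.hasDerivAt_eq_zero hf

theorem metapop_susceptible_positive {n : ℕ} (hn : 1 ≤ n)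
    (dH γH dm sL : ℝ) (hdH : 0 < dH) (hγH : 0 < γH) (hdm : 0 < dm) (hsL : 0 ≤ sL)
    (βH βm Lc g : Fin n → ℝ)
    (hβH : ∀ i, 0 < βH i) (hβm : ∀ i, 0 < βm i)
    (hLc : ∀ i, 0 ≤ Lc i) (hg : ∀ i, 0 ≤ g i)
    (m r : Fin n → Fin n → ℝ)
    (hm : ∀ j i, 0 ≤ m j i) (hmii : ∀ i, m i i = 0)
    (hr : ∀ i j, 0 ≤ r i j) (hrii : ∀ i, r i i = 0)
    (S I R : Fin n → Fin n → ℝ → ℝ) (Sm Im : Fin n → ℝ → ℝ)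
    (Np Nr : Fin n → ℝ → ℝ)
    (hNp : ∀ i t, Np i t = ∑ j, (S j i t + I j i t + R j i t))
    (hNr : ∀ i t, Nr i t = ∑ j, (S i j t + I i j t + R i j t))
    (hNppos : ∀ i t, 0 ≤ t → 0 < Np i t)
    (hderivS : ∀ (i : Fin n) (t : ℝ), 0 ≤ t →
      HasDerivAt (S i i)
        (dH * (Nr i t - S i i t) - g i * S i i t + (∑ k, r i k * S i k t)
          - βH i * (Im i t / Np i t) * S i i t) t)
    (hderivSoff : ∀ (i j : Fin n), j ≠ i → ∀ (t : ℝ), 0 ≤ t →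
      HasDerivAt (S i j)
        (g i * m j i * S i i t - dH * S i j t - r i j * S i j t
          - βH j * (Im j t / Np j t) * S i j t) t)
    (hderivI : ∀ (i : Fin n) (t : ℝ), 0 ≤ t →
      HasDerivAt (I i i)
        (-(dH + γH + g i) * I i i t + (∑ k, r i k * I i k t)
          + βH i * (Im i t / Np i t) * S i i t) t)
    (hderivIoff : ∀ (i j : Fin n), j ≠ i → ∀ (t : ℝ), 0 ≤ t →
      HasDerivAt (I i j)
        (g i * m j i * I i i t - (dH + γH + r i j) * I i j t
          + βH j * (Im j t / Np j t) * S i j t) t)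
    (hderivR : ∀ (i : Fin n) (t : ℝ), 0 ≤ t →
      HasDerivAt (R i i)
        (γH * I i i t - (dH + g i) * R i i t + (∑ k, r i k * R i k t)) t)
    (hderivRoff : ∀ (i j : Fin n), j ≠ i → ∀ (t : ℝ), 0 ≤ t →
      HasDerivAt (R i j)
        (g i * m j i * R i i t + γH * I i j t - (dH + r i j) * R i j t) t)
    (hderivSm : ∀ (i : Fin n) (t : ℝ), 0 ≤ t →
      HasDerivAt (Sm i)
        (sL * Lc i - dm * Sm i t - βm i * (Sm i t / Np i t) * ∑ k, I k i t) t)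
    (hderivIm : ∀ (i : Fin n) (t : ℝ), 0 ≤ t →
      HasDerivAt (Im i)
        (βm i * (Sm i t / Np i t) * (∑ k, I k i t) - dm * Im i t) t)
    (hnonneg : ∀ t : ℝ, 0 ≤ t →
      (∀ i j, 0 ≤ S i j t) ∧ (∀ i j, 0 ≤ I i j t) ∧ (∀ i j, 0 ≤ R i j t) ∧
      (∀ i, 0 ≤ Sm i t) ∧ (∀ i, 0 ≤ Im i t))
    (hNr0 : ∀ i, 0 < Nr i 0) :
    ∀ t : ℝ, 0 < t →
      (∀ i, 0 < S i i t) ∧ (∀ i j, 0 < g i * m j i → 0 < S i j t) := by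
  have hS : ∀ i j t, 0 ≤ t → 0 ≤ S i j t := fun i j t ht => (hnonneg t ht).1 i j
  have hI : ∀ i j t, 0 ≤ t → 0 ≤ I i j t := fun i j t ht => (hnonneg t ht).2.1 i j
  have hR : ∀ i j t, 0 ≤ t → 0 ≤ R i j t := fun i j t ht => (hnonneg t ht).2.2.1 i j
  have hNrpos : ∀ i t, 0 ≤ t → 0 < Nr i t := by
    intro i
    have hterm : ∀ j t, 0 ≤ t → HasDerivAt (fun t => S i j t + I i j t + R i j t)
        (g i * (S i i t + I i i t + R i i t) * m j i - dH * (S i j t + I i j t + R i j t)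
          - r i j * (S i j t + I i j t + R i j t)
          + (if j = i then dH * Nr i t - g i * (S i i t + I i i t + R i i t)
              + ∑ k, r i k * (S i k t + I i k t + R i k t) else 0)) t := by
      intro j t ht
      by_cases hji : j = i
      · subst hji
        have h := ((hderivS j t ht).add (hderivI j t ht)).add (hderivR j t ht)
        refine HasDerivAt.congr_deriv h ?_
        simp only [if_true, hmii, hrii, mul_add, Finset.sum_add_distrib]
        ring
      · have h := ((hderivSoff i j hji t ht).add (hderivIoff i j hji t ht)).add
          (hderivRoff i j hji t ht)
        refine HasDerivAt.congr_deriv h ?_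
        simp only [if_neg hji]
        ring
    have hd : ∀ t, 0 ≤ t → HasDerivAt (Nr i)
        (g i * (S i i t + I i i t + R i i t) * (∑ j, m j i)
          - g i * (S i i t + I i i t + R i i t)) t := by
      intro t ht
      have h := HasDerivAt.fun_sum (u := Finset.univ) (fun j _ => hterm j t ht)
      have he : Nr i = fun t => ∑ j, (S i j t + I i j t + R i j t) := funext (hNr i)
      rw [he]
      refine HasDerivAt.congr_deriv h ?_
      rw [Finset.sum_add_distrib, Finset.sum_sub_distrib, Finset.sum_sub_distrib,
        Finset.sum_ite_eq' Finset.univ i, if_pos (Finset.mem_univ i), ← Finset.mul_sum,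
        ← Finset.mul_sum, ← hNr i t]
      ring
    refine aux_pos_of_deriv_ge (Nr i) _ (g i) hd ?_ (hNr0 i)
    intro t ht
    have hle : S i i t + I i i t + R i i t ≤ Nr i t := by
      rw [hNr i t]
      exact Finset.single_le_sum (f := fun j => S i j t + I i j t + R i j t)
        (fun j _ => add_nonneg (add_nonneg (hS i j t ht) (hI i j t ht)) (hR i j t ht))
        (Finset.mem_univ i)
    have h1 := mul_le_mul_of_nonneg_left hle (hg i)
    have h2 : 0 ≤ g i * (S i i t + I i i t + R i i t) * (∑ j, m j i) :=
      mul_nonneg (mul_nonneg (hg i)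
        (add_nonneg (add_nonneg (hS i i t ht) (hI i i t ht)) (hR i i t ht)))
        (Finset.sum_nonneg fun j _ => hm j i)
    linarith
  intro t ht
  have hdiag : ∀ i, 0 < S i i t := by
    intro i
    refine lt_of_le_of_ne (hS i i t ht.le) fun h0 => ?_
    have h := aux_deriv_zero _ _ t ht (hderivS i t ht.le) (hS i i) h0.symm
    rw [← h0] at h
    have h1 : 0 ≤ ∑ k, r i k * S i k t :=
      Finset.sum_nonneg fun k _ => mul_nonneg (hr i k) (hS i k t ht.le)
    have h2 := mul_pos hdH (hNrpos i t ht.le)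
    simp only [sub_zero, mul_zero] at h
    linarith
  refine ⟨hdiag, fun i j hgm => ?_⟩
  have hji : j ≠ i := by
    rintro rfl
    rw [hmii, mul_zero] at hgm
    exact lt_irrefl _ hgm
  refine lt_of_le_of_ne (hS i j t ht.le) fun h0 => ?_
  have h := aux_deriv_zero _ _ t ht (hderivSoff i j hji t ht.le) (hS i j) h0.symm
  rw [← h0] at h
  have h2 := mul_pos hgm (hdiag i)
  simp only [sub_zero, mul_zero] at h
  linarith
end

section
/- Consider the metapopulation ODE system for chikungunya on n nodes with a nonnegative solution defined on [0, ∞), and assume the travel fractions satisfy Σ_j m_{ji} = 1 for every i. Then every component of the solution is bounded on [0, ∞): the human variables are bounded by the (constant) total resident population, and the mosquito variables satisfy Sm_i(t) + Im_i(t) ≤ max(Sm_i(0) + Im_i(0), s_L L_i / d_m) for all t ≥ 0. -/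
theorem const_of_deriv_zero_aux (f : ℝ → ℝ) (hf : ∀ t, 0 ≤ t → HasDerivAt f 0 t)
    (t : ℝ) (ht : 0 ≤ t) : f t = f 0 :=
  constant_of_has_deriv_right_zero (a := 0) (b := t)
    (fun x hx => (hf x hx.1).continuousAt.continuousWithinAt)
    (fun x hx => (hf x hx.1).hasDerivWithinAt) t ⟨ht, le_rfl⟩

theorem mosq_aux (V : ℝ → ℝ) (a d : ℝ) (hd : 0 < d)
    (hV : ∀ t, 0 ≤ t → HasDerivAt V (a - d * V t) t)
    (t : ℝ) (ht : 0 ≤ t) : V t ≤ max (V 0) (a / d) := by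
  have h := const_of_deriv_zero_aux (fun t => (V t - a / d) * Real.exp (d * t))
    (fun s hs => by
      have h1 : HasDerivAt (fun t => Real.exp (d * t)) (Real.exp (d * s) * (d * 1)) s :=
        ((hasDerivAt_id s).const_mul d).exp
      have h2 := ((hV s hs).sub_const (a / d)).mul h1
      refine h2.congr_deriv ?_
      field_simp
      ring) t ht
  simp only [mul_zero, Real.exp_zero, mul_one] at h
  have he : 1 ≤ Real.exp (d * t) := Real.one_le_exp (by positivity)
  by_contra hc
  rw [not_le, max_lt_iff] at hc
  nlinarith [mul_nonneg (sub_nonneg.2 hc.2.le) (sub_nonneg.2 he)]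

theorem metapop_solutions_bounded {n : ℕ} (hn : 1 ≤ n)
    (dH γH dm sL : ℝ) (hdH : 0 < dH) (hγH : 0 < γH) (hdm : 0 < dm) (hsL : 0 ≤ sL)
    (βH βm Lc g : Fin n → ℝ)
    (hβH : ∀ i, 0 < βH i) (hβm : ∀ i, 0 < βm i)
    (hLc : ∀ i, 0 ≤ Lc i) (hg : ∀ i, 0 ≤ g i)
    (m r : Fin n → Fin n → ℝ)
    (hm : ∀ j i, 0 ≤ m j i) (hmii : ∀ i, m i i = 0)
    (hr : ∀ i j, 0 ≤ r i j) (hrii : ∀ i, r i i = 0)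
    (S I R : Fin n → Fin n → ℝ → ℝ) (Sm Im : Fin n → ℝ → ℝ)
    (Np Nr : Fin n → ℝ → ℝ)
    (hNp : ∀ i t, Np i t = ∑ j, (S j i t + I j i t + R j i t))
    (hNr : ∀ i t, Nr i t = ∑ j, (S i j t + I i j t + R i j t))
    (hNppos : ∀ i t, 0 ≤ t → 0 < Np i t)
    (hderivS : ∀ (i : Fin n) (t : ℝ), 0 ≤ t →
      HasDerivAt (S i i)
        (dH * (Nr i t - S i i t) - g i * S i i t + (∑ k, r i k * S i k t)
          - βH i * (Im i t / Np i t) * S i i t) t)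
    (hderivSoff : ∀ (i j : Fin n), j ≠ i → ∀ (t : ℝ), 0 ≤ t →
      HasDerivAt (S i j)
        (g i * m j i * S i i t - dH * S i j t - r i j * S i j t
          - βH j * (Im j t / Np j t) * S i j t) t)
    (hderivI : ∀ (i : Fin n) (t : ℝ), 0 ≤ t →
      HasDerivAt (I i i)
        (-(dH + γH + g i) * I i i t + (∑ k, r i k * I i k t)
          + βH i * (Im i t / Np i t) * S i i t) t)
    (hderivIoff : ∀ (i j : Fin n), j ≠ i → ∀ (t : ℝ), 0 ≤ t →
      HasDerivAt (I i j)
        (g i * m j i * I i i t - (dH + γH + r i j) * I i j t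
          + βH j * (Im j t / Np j t) * S i j t) t)
    (hderivR : ∀ (i : Fin n) (t : ℝ), 0 ≤ t →
      HasDerivAt (R i i)
        (γH * I i i t - (dH + g i) * R i i t + (∑ k, r i k * R i k t)) t)
    (hderivRoff : ∀ (i j : Fin n), j ≠ i → ∀ (t : ℝ), 0 ≤ t →
      HasDerivAt (R i j)
        (g i * m j i * R i i t + γH * I i j t - (dH + r i j) * R i j t) t)
    (hderivSm : ∀ (i : Fin n) (t : ℝ), 0 ≤ t →
      HasDerivAt (Sm i)
        (sL * Lc i - dm * Sm i t - βm i * (Sm i t / Np i t) * ∑ k, I k i t) t)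
    (hderivIm : ∀ (i : Fin n) (t : ℝ), 0 ≤ t →
      HasDerivAt (Im i)
        (βm i * (Sm i t / Np i t) * (∑ k, I k i t) - dm * Im i t) t)
    (hmsum : ∀ i, (∑ j, m j i) = 1)
    (hnonneg : ∀ t : ℝ, 0 ≤ t →
      (∀ i j, 0 ≤ S i j t) ∧ (∀ i j, 0 ≤ I i j t) ∧ (∀ i j, 0 ≤ R i j t) ∧
      (∀ i, 0 ≤ Sm i t) ∧ (∀ i, 0 ≤ Im i t)) :
    ∀ t : ℝ, 0 ≤ t →
      (∀ i j, S i j t ≤ ∑ k, Nr k 0) ∧ (∀ i j, I i j t ≤ ∑ k, Nr k 0) ∧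
      (∀ i j, R i j t ≤ ∑ k, Nr k 0) ∧
      (∀ i, Sm i t + Im i t ≤ max (Sm i 0 + Im i 0) (sL * Lc i / dm)) := by
  have hN : ∀ i j t, 0 ≤ t → HasDerivAt (fun t => S i j t + I i j t + R i j t)
      (g i * m j i * (S i i t + I i i t + R i i t) - dH * (S i j t + I i j t + R i j t)
        - r i j * (S i j t + I i j t + R i j t)
        + (if j = i then dH * Nr i t - g i * (S i i t + I i i t + R i i t)
            + ∑ k, r i k * (S i k t + I i k t + R i k t) else 0)) t := by
    intro i j t ht
    by_cases hj : j = i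
    · subst hj
      refine (((hderivS j t ht).add (hderivI j t ht)).add (hderivR j t ht)).congr_deriv ?_
      simp only [hmii, hrii, if_true, mul_add, Finset.sum_add_distrib]
      ring
    · refine (((hderivSoff i j hj t ht).add (hderivIoff i j hj t ht)).add
        (hderivRoff i j hj t ht)).congr_deriv ?_
      simp only [hj, if_false]
      ring
  have hNr0 : ∀ i t, 0 ≤ t → Nr i t = Nr i 0 := by
    intro i
    refine const_of_deriv_zero_aux (Nr i) (fun t ht => ?_)
    have he : Nr i = fun t => ∑ j, (S i j t + I i j t + R i j t) := funext (hNr i)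
    have h := HasDerivAt.fun_sum (u := Finset.univ) (fun j _ => hN i j t ht)
    rw [← he] at h
    refine h.congr_deriv ?_
    rw [Finset.sum_add_distrib, Finset.sum_sub_distrib, Finset.sum_sub_distrib,
      ← Finset.sum_mul, ← Finset.mul_sum, ← Finset.mul_sum, hmsum, ← hNr]
    simp only [Finset.sum_ite_eq', Finset.mem_univ, if_true]
    ring
  intro t ht
  obtain ⟨hS, hI, hR, -, -⟩ := hnonneg t ht
  have key : ∀ i j, S i j t + I i j t + R i j t ≤ ∑ k, Nr k 0 := by
    intro i j
    have hpos : ∀ k l, 0 ≤ S k l t + I k l t + R k l t := fun k l =>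
      add_nonneg (add_nonneg (hS k l) (hI k l)) (hR k l)
    have h1 : S i j t + I i j t + R i j t ≤ Nr i t := by
      rw [hNr]
      exact Finset.single_le_sum (f := fun l => S i l t + I i l t + R i l t)
        (fun l _ => hpos i l) (Finset.mem_univ j)
    have h2 : Nr i 0 ≤ ∑ k, Nr k 0 :=
      Finset.single_le_sum (f := fun k => Nr k 0)
        (fun k _ => by
          rw [← hNr0 k t ht, hNr]
          exact Finset.sum_nonneg (fun l _ => hpos k l)) (Finset.mem_univ i)
    rw [hNr0 i t ht] at h1
    exact h1.trans h2
  refine ⟨fun i j => ?_, fun i j => ?_, fun i j => ?_, fun i => ?_⟩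
  · linarith [key i j, hS i j, hI i j, hR i j]
  · linarith [key i j, hS i j, hI i j, hR i j]
  · linarith [key i j, hS i j, hI i j, hR i j]
  · refine mosq_aux (fun t => Sm i t + Im i t) (sL * Lc i) dm hdm (fun s hs => ?_) t ht
    refine ((hderivSm i s hs).add (hderivIm i s hs)).congr_deriv ?_
    ring
end

section
/- Suppose the metapopulation system is at equilibrium, node i is at the disease-free equilibrium (I_{ki} = 0 for all k and Im_i = 0), and S_{iv} > 0 for every v in V_{i→} = {k ≠ i : g_i m_{ki} > 0} (with r_{iv} > 0 for each such v). Then Im_v = 0 for every v ∈ V_{i→}. -/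
theorem metapop_DFE_neighbor_mosquitoes {n : ℕ} (hn : 1 ≤ n)
    (dH γH dm sL : ℝ) (hdH : 0 < dH) (hγH : 0 < γH) (hdm : 0 < dm) (hsL : 0 ≤ sL)
    (βH βm Lc g : Fin n → ℝ)
    (hβH : ∀ i, 0 < βH i) (hβm : ∀ i, 0 < βm i)
    (hLc : ∀ i, 0 ≤ Lc i) (hg : ∀ i, 0 ≤ g i)
    (m r : Fin n → Fin n → ℝ)
    (hm : ∀ j i, 0 ≤ m j i) (hmii : ∀ i, m i i = 0)
    (hr : ∀ i j, 0 ≤ r i j) (hrii : ∀ i, r i i = 0)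
    (S I R : Fin n → Fin n → ℝ) (Sm Im : Fin n → ℝ)
    (hSnn : ∀ i j, 0 ≤ S i j) (hInn : ∀ i j, 0 ≤ I i j) (hRnn : ∀ i j, 0 ≤ R i j)
    (hSmnn : ∀ i, 0 ≤ Sm i) (hImnn : ∀ i, 0 ≤ Im i)
    (Np Nr : Fin n → ℝ)
    (hNp : ∀ i, Np i = ∑ j, (S j i + I j i + R j i))
    (hNr : ∀ i, Nr i = ∑ j, (S i j + I i j + R i j))
    (hNppos : ∀ i, 0 < Np i)
    (heqa : ∀ i, dH * (Nr i - S i i) - g i * S i i + (∑ k, r i k * S i k)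
      - βH i * (Im i / Np i) * S i i = 0)
    (heqb : ∀ i j, j ≠ i → g i * m j i * S i i - dH * S i j - r i j * S i j
      - βH j * (Im j / Np j) * S i j = 0)
    (heqc : ∀ i, -(dH + γH + g i) * I i i + (∑ k, r i k * I i k)
      + βH i * (Im i / Np i) * S i i = 0)
    (heqd : ∀ i j, j ≠ i → g i * m j i * I i i - (dH + γH + r i j) * I i j
      + βH j * (Im j / Np j) * S i j = 0)
    (heqe : ∀ i, γH * I i i - (dH + g i) * R i i + (∑ k, r i k * R i k) = 0)
    (heqf : ∀ i j, j ≠ i → g i * m j i * R i i + γH * I i j - (dH + r i j) * R i j = 0)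
    (heqg : ∀ i, sL * Lc i - dm * Sm i - βm i * (Sm i / Np i) * (∑ k, I k i) = 0)
    (heqh : ∀ i, βm i * (Sm i / Np i) * (∑ k, I k i) - dm * Im i = 0)
    (i : Fin n) (hDFEh : ∀ k, I k i = 0) (hDFEm : Im i = 0)
    (hrpos : ∀ v, v ≠ i → 0 < g i * m v i → 0 < r i v)
    (hSpos : ∀ v, v ≠ i → 0 < g i * m v i → 0 < S i v) :
    ∀ v, v ≠ i → 0 < g i * m v i → Im v = 0 := by
  intro v hv hgm
  have hrv := hrpos v hv hgm
  have hSv := hSpos v hv hgm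
  have hc := heqc i
  rw [hDFEh i, hDFEm] at hc
  have hsum : ∑ k, r i k * I i k = 0 := by simpa using hc
  have h0 : r i v * I i v = 0 :=
    (Finset.sum_eq_zero_iff_of_nonneg
      (fun k _ => mul_nonneg (hr i k) (hInn i k))).1 hsum v (Finset.mem_univ v)
  have hIv : I i v = 0 := (mul_eq_zero.1 h0).resolve_left hrv.ne'
  have hd := heqd i v hv
  rw [hDFEh i, hIv] at hd
  have h1 : βH v * (Im v / Np v) * S i v = 0 := by simpa only [mul_zero, sub_zero, zero_add] using hd
  have h2 := (mul_eq_zero.1 h1).resolve_right hSv.ne'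
  have h3 := (mul_eq_zero.1 h2).resolve_left (hβH v).ne'
  exact (div_eq_zero_iff.1 h3).resolve_right (hNppos v).ne'
end

section
/- Suppose the metapopulation system is at equilibrium, that S_{ij} > 0 whenever g_i m_{ji} > 0, that Sm_i > 0 for all i, and that r_{ij} > 0 whenever g_i m_{ji} > 0. If node i is at the disease-free equilibrium, then every node reachable from node i (every node in A_{i→}) is at the disease-free equilibrium. -/
theorem metapop_DFE_spreads_forward {n : ℕ} (hn : 1 ≤ n)
    (dH γH dm sL : ℝ) (hdH : 0 < dH) (hγH : 0 < γH) (hdm : 0 < dm) (hsL : 0 ≤ sL)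
    (βH βm Lc g : Fin n → ℝ)
    (hβH : ∀ i, 0 < βH i) (hβm : ∀ i, 0 < βm i)
    (hLc : ∀ i, 0 ≤ Lc i) (hg : ∀ i, 0 ≤ g i)
    (m r : Fin n → Fin n → ℝ)
    (hm : ∀ j i, 0 ≤ m j i) (hmii : ∀ i, m i i = 0)
    (hr : ∀ i j, 0 ≤ r i j) (hrii : ∀ i, r i i = 0)
    (S I R : Fin n → Fin n → ℝ) (Sm Im : Fin n → ℝ)
    (hSnn : ∀ i j, 0 ≤ S i j) (hInn : ∀ i j, 0 ≤ I i j) (hRnn : ∀ i j, 0 ≤ R i j)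
    (hSmnn : ∀ i, 0 ≤ Sm i) (hImnn : ∀ i, 0 ≤ Im i)
    (Np Nr : Fin n → ℝ)
    (hNp : ∀ i, Np i = ∑ j, (S j i + I j i + R j i))
    (hNr : ∀ i, Nr i = ∑ j, (S i j + I i j + R i j))
    (hNppos : ∀ i, 0 < Np i)
    (heqa : ∀ i, dH * (Nr i - S i i) - g i * S i i + (∑ k, r i k * S i k)
      - βH i * (Im i / Np i) * S i i = 0)
    (heqb : ∀ i j, j ≠ i → g i * m j i * S i i - dH * S i j - r i j * S i j
      - βH j * (Im j / Np j) * S i j = 0)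
    (heqc : ∀ i, -(dH + γH + g i) * I i i + (∑ k, r i k * I i k)
      + βH i * (Im i / Np i) * S i i = 0)
    (heqd : ∀ i j, j ≠ i → g i * m j i * I i i - (dH + γH + r i j) * I i j
      + βH j * (Im j / Np j) * S i j = 0)
    (heqe : ∀ i, γH * I i i - (dH + g i) * R i i + (∑ k, r i k * R i k) = 0)
    (heqf : ∀ i j, j ≠ i → g i * m j i * R i i + γH * I i j - (dH + r i j) * R i j = 0)
    (heqg : ∀ i, sL * Lc i - dm * Sm i - βm i * (Sm i / Np i) * (∑ k, I k i) = 0)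
    (heqh : ∀ i, βm i * (Sm i / Np i) * (∑ k, I k i) - dm * Im i = 0)
    (hSpos : ∀ a b, 0 < g a * m b a → 0 < S a b)
    (hSmpos : ∀ a, 0 < Sm a)
    (hrpos : ∀ a b, 0 < g a * m b a → 0 < r a b)
    (i : Fin n) (hDFEh : ∀ k, I k i = 0) (hDFEm : Im i = 0) :
    ∀ k, Relation.ReflTransGen (fun a b => 0 < g a * m b a) i k →
      (∀ j, I j k = 0) ∧ Im k = 0 := by
  intro k hk
  induction hk with
  | refl => exact ⟨hDFEh, hDFEm⟩
  | @tail a b _ hab ih =>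
    obtain ⟨hI, hIm⟩ := ih
    have hba : b ≠ a := by
      rintro rfl
      simp [hmii] at hab
    have hc := heqc a
    rw [hI a, hIm] at hc
    have hsum : ∑ k, r a k * I a k = 0 := by simpa using hc
    have hterm := (Finset.sum_eq_zero_iff_of_nonneg
      (fun k _ => mul_nonneg (hr a k) (hInn a k))).1 hsum b (Finset.mem_univ b)
    have hIab : I a b = 0 := (mul_eq_zero.1 hterm).resolve_left (hrpos a b hab).ne'
    have hd := heqd a b hba
    rw [hI a, hIab] at hd
    have hImb : Im b = 0 := by
      have h1 := (hβH b).ne'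
      have h2 := (hNppos b).ne'
      have h3 := (hSpos a b hab).ne'
      simpa [h1, h2, h3] using hd
    refine ⟨?_, hImb⟩
    have hh := heqh b
    rw [hImb] at hh
    have hs : ∑ k, I k b = 0 := by
      have h1 := (hβm b).ne'
      have h2 := (hNppos b).ne'
      have h3 := (hSmpos b).ne'
      simpa [h1, h2, h3] using hh
    intro j
    exact (Finset.sum_eq_zero_iff_of_nonneg (fun k _ => hInn k b)).1 hs j (Finset.mem_univ j)
end

section
/- Suppose the metapopulation system is at equilibrium, that S_{ii} > 0 for all i, and that Sm_i > 0 for all i. If node i is at the disease-free equilibrium, then every node that has access to node i (every node in A_{→i}) is at the disease-free equilibrium. -/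
theorem metapop_DFE_spreads_backward {n : ℕ} (hn : 1 ≤ n)
    (dH γH dm sL : ℝ) (hdH : 0 < dH) (hγH : 0 < γH) (hdm : 0 < dm) (hsL : 0 ≤ sL)
    (βH βm Lc g : Fin n → ℝ)
    (hβH : ∀ i, 0 < βH i) (hβm : ∀ i, 0 < βm i)
    (hLc : ∀ i, 0 ≤ Lc i) (hg : ∀ i, 0 ≤ g i)
    (m r : Fin n → Fin n → ℝ)
    (hm : ∀ j i, 0 ≤ m j i) (hmii : ∀ i, m i i = 0)
    (hr : ∀ i j, 0 ≤ r i j) (hrii : ∀ i, r i i = 0)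
    (S I R : Fin n → Fin n → ℝ) (Sm Im : Fin n → ℝ)
    (hSnn : ∀ i j, 0 ≤ S i j) (hInn : ∀ i j, 0 ≤ I i j) (hRnn : ∀ i j, 0 ≤ R i j)
    (hSmnn : ∀ i, 0 ≤ Sm i) (hImnn : ∀ i, 0 ≤ Im i)
    (Np Nr : Fin n → ℝ)
    (hNp : ∀ i, Np i = ∑ j, (S j i + I j i + R j i))
    (hNr : ∀ i, Nr i = ∑ j, (S i j + I i j + R i j))
    (hNppos : ∀ i, 0 < Np i)
    (heqa : ∀ i, dH * (Nr i - S i i) - g i * S i i + (∑ k, r i k * S i k)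
      - βH i * (Im i / Np i) * S i i = 0)
    (heqb : ∀ i j, j ≠ i → g i * m j i * S i i - dH * S i j - r i j * S i j
      - βH j * (Im j / Np j) * S i j = 0)
    (heqc : ∀ i, -(dH + γH + g i) * I i i + (∑ k, r i k * I i k)
      + βH i * (Im i / Np i) * S i i = 0)
    (heqd : ∀ i j, j ≠ i → g i * m j i * I i i - (dH + γH + r i j) * I i j
      + βH j * (Im j / Np j) * S i j = 0)
    (heqe : ∀ i, γH * I i i - (dH + g i) * R i i + (∑ k, r i k * R i k) = 0)
    (heqf : ∀ i j, j ≠ i → g i * m j i * R i i + γH * I i j - (dH + r i j) * R i j = 0)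
    (heqg : ∀ i, sL * Lc i - dm * Sm i - βm i * (Sm i / Np i) * (∑ k, I k i) = 0)
    (heqh : ∀ i, βm i * (Sm i / Np i) * (∑ k, I k i) - dm * Im i = 0)
    (hSdiagpos : ∀ a, 0 < S a a)
    (hSmpos : ∀ a, 0 < Sm a)
    (i : Fin n) (hDFEh : ∀ k, I k i = 0) (hDFEm : Im i = 0) :
    ∀ k, Relation.ReflTransGen (fun a b => 0 < g a * m b a) k i →
      (∀ j, I j k = 0) ∧ Im k = 0 := by
  intro k hk
  induction hk using Relation.ReflTransGen.head_induction_on with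
  | refl => exact ⟨hDFEh, hDFEm⟩
  | @head a b hab _ ih =>
    obtain ⟨hI, hM⟩ := ih
    have hne : b ≠ a := by
      rintro rfl
      rw [hmii] at hab
      simp at hab
    have h1 : I a a = 0 := by
      have h := heqd a b hne
      rw [hI a, hM] at h
      have h2 : g a * m b a * I a a = 0 := by simpa using h
      exact (mul_eq_zero.mp h2).resolve_left hab.ne'
    have h3 : Im a = 0 := by
      have h := heqc a
      rw [h1] at h
      have hs : 0 ≤ ∑ k, r a k * I a k :=
        Finset.sum_nonneg fun k _ => mul_nonneg (hr a k) (hInn a k)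
      by_contra hc
      have hp : 0 < Im a := lt_of_le_of_ne (hImnn a) (Ne.symm hc)
      have := mul_pos (mul_pos (hβH a) (div_pos hp (hNppos a))) (hSdiagpos a)
      linarith
    refine ⟨?_, h3⟩
    have h := heqh a
    rw [h3] at h
    have hpos := mul_pos (hβm a) (div_pos (hSmpos a) (hNppos a))
    have h4 : βm a * (Sm a / Np a) * (∑ k, I k a) = 0 := by linarith
    have h5 := (mul_eq_zero.mp h4).resolve_left hpos.ne'
    intro j
    exact (Finset.sum_eq_zero_iff_of_nonneg (fun k _ => hInn k a)).mp h5 j (Finset.mem_univ j)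
end

section
/- Suppose the metapopulation system is at equilibrium, that S_{ii} > 0 and Sm_i > 0 for all i, that S_{ij} > 0 and r_{ij} > 0 whenever g_i m_{ji} > 0, and that the outgoing travel matrix M^T = [g_i m_{ji}] is irreducible (for every pair of distinct nodes i, j there is a finite chain i = k_0, k_1, …, k_q = j with g_{k_t} m_{k_{t+1} k_t} > 0 for each t). If some node is at the disease-free equilibrium, then every node is at the disease-free equilibrium. -/
theorem metapop_DFE_irreducible_all {n : ℕ} (hn : 1 ≤ n)
    (dH γH dm sL : ℝ) (hdH : 0 < dH) (hγH : 0 < γH) (hdm : 0 < dm) (hsL : 0 ≤ sL)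
    (βH βm Lc g : Fin n → ℝ)
    (hβH : ∀ i, 0 < βH i) (hβm : ∀ i, 0 < βm i)
    (hLc : ∀ i, 0 ≤ Lc i) (hg : ∀ i, 0 ≤ g i)
    (m r : Fin n → Fin n → ℝ)
    (hm : ∀ j i, 0 ≤ m j i) (hmii : ∀ i, m i i = 0)
    (hr : ∀ i j, 0 ≤ r i j) (hrii : ∀ i, r i i = 0)
    (S I R : Fin n → Fin n → ℝ) (Sm Im : Fin n → ℝ)
    (hSnn : ∀ i j, 0 ≤ S i j) (hInn : ∀ i j, 0 ≤ I i j) (hRnn : ∀ i j, 0 ≤ R i j)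
    (hSmnn : ∀ i, 0 ≤ Sm i) (hImnn : ∀ i, 0 ≤ Im i)
    (Np Nr : Fin n → ℝ)
    (hNp : ∀ i, Np i = ∑ j, (S j i + I j i + R j i))
    (hNr : ∀ i, Nr i = ∑ j, (S i j + I i j + R i j))
    (hNppos : ∀ i, 0 < Np i)
    (heqa : ∀ i, dH * (Nr i - S i i) - g i * S i i + (∑ k, r i k * S i k)
      - βH i * (Im i / Np i) * S i i = 0)
    (heqb : ∀ i j, j ≠ i → g i * m j i * S i i - dH * S i j - r i j * S i j
      - βH j * (Im j / Np j) * S i j = 0)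
    (heqc : ∀ i, -(dH + γH + g i) * I i i + (∑ k, r i k * I i k)
      + βH i * (Im i / Np i) * S i i = 0)
    (heqd : ∀ i j, j ≠ i → g i * m j i * I i i - (dH + γH + r i j) * I i j
      + βH j * (Im j / Np j) * S i j = 0)
    (heqe : ∀ i, γH * I i i - (dH + g i) * R i i + (∑ k, r i k * R i k) = 0)
    (heqf : ∀ i j, j ≠ i → g i * m j i * R i i + γH * I i j - (dH + r i j) * R i j = 0)
    (heqg : ∀ i, sL * Lc i - dm * Sm i - βm i * (Sm i / Np i) * (∑ k, I k i) = 0)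
    (heqh : ∀ i, βm i * (Sm i / Np i) * (∑ k, I k i) - dm * Im i = 0)
    (hSdiagpos : ∀ a, 0 < S a a)
    (hSmpos : ∀ a, 0 < Sm a)
    (hSpos : ∀ a b, 0 < g a * m b a → 0 < S a b)
    (hrpos : ∀ a b, 0 < g a * m b a → 0 < r a b)
    (hirr : ∀ a b : Fin n, a ≠ b →
      Relation.TransGen (fun x y => 0 < g x * m y x) a b)
    (i : Fin n) (hDFEh : ∀ k, I k i = 0) (hDFEm : Im i = 0) :
    ∀ v : Fin n, (∀ k, I k v = 0) ∧ Im v = 0 := by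
  have step : ∀ x y : Fin n, 0 < g x * m y x → ((∀ k, I k x = 0) ∧ Im x = 0) →
      ((∀ k, I k y = 0) ∧ Im y = 0) := by
    rintro x y hxy ⟨hI, hI0⟩
    have hne : y ≠ x := by
      rintro rfl
      simp [hmii] at hxy
    have hc := heqc x
    rw [hI x, hI0] at hc
    have hsum : ∑ k, r x k * I x k = 0 := by simpa using hc
    have hz := (Finset.sum_eq_zero_iff_of_nonneg
      (fun k _ => mul_nonneg (hr x k) (hInn x k))).1 hsum y (Finset.mem_univ y)
    have hIxy : I x y = 0 := (mul_eq_zero.1 hz).resolve_left (hrpos x y hxy).ne'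
    have hd := heqd x y hne
    rw [hI x, hIxy] at hd
    have hIm : Im y = 0 := by
      simpa [(hβH y).ne', (hNppos y).ne', (hSpos x y hxy).ne'] using hd
    have hh := heqh y
    rw [hIm] at hh
    have hs : ∑ k, I k y = 0 := by
      simpa only [mul_zero, sub_zero, mul_eq_zero, div_eq_zero_iff, (hβm y).ne',
        (hNppos y).ne', (hSmpos y).ne', false_or, or_false] using hh
    exact ⟨fun k => (Finset.sum_eq_zero_iff_of_nonneg (fun k _ => hInn k y)).1 hs k
      (Finset.mem_univ k), hIm⟩
  intro v
  by_cases hv : i = v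
  · subst hv
    exact ⟨hDFEh, hDFEm⟩
  · have h := hirr i v hv
    induction h with
    | single h => exact step _ _ h ⟨hDFEh, hDFEm⟩
    | @tail b c hab hbc ih =>
      by_cases hb : i = b
      · subst hb
        exact step _ _ hbc ⟨hDFEh, hDFEm⟩
      · exact step _ _ hbc (ih hb)
end

section
/- Suppose the metapopulation system is at equilibrium, that S_{ii} > 0 for all i, and that Sm_i > 0 for all i. If the disease is endemic at node i, i.e. there exists q ∈ {1, …, n} with I_{qi} > 0, then I_{ii} > 0. -/
theorem metapop_endemic_implies_diag_positive {n : ℕ} (hn : 1 ≤ n)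
    (dH γH dm sL : ℝ) (hdH : 0 < dH) (hγH : 0 < γH) (hdm : 0 < dm) (hsL : 0 ≤ sL)
    (βH βm Lc g : Fin n → ℝ)
    (hβH : ∀ i, 0 < βH i) (hβm : ∀ i, 0 < βm i)
    (hLc : ∀ i, 0 ≤ Lc i) (hg : ∀ i, 0 ≤ g i)
    (m r : Fin n → Fin n → ℝ)
    (hm : ∀ j i, 0 ≤ m j i) (hmii : ∀ i, m i i = 0)
    (hr : ∀ i j, 0 ≤ r i j) (hrii : ∀ i, r i i = 0)
    (S I R : Fin n → Fin n → ℝ) (Sm Im : Fin n → ℝ)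
    (hSnn : ∀ i j, 0 ≤ S i j) (hInn : ∀ i j, 0 ≤ I i j) (hRnn : ∀ i j, 0 ≤ R i j)
    (hSmnn : ∀ i, 0 ≤ Sm i) (hImnn : ∀ i, 0 ≤ Im i)
    (Np Nr : Fin n → ℝ)
    (hNp : ∀ i, Np i = ∑ j, (S j i + I j i + R j i))
    (hNr : ∀ i, Nr i = ∑ j, (S i j + I i j + R i j))
    (hNppos : ∀ i, 0 < Np i)
    (heqa : ∀ i, dH * (Nr i - S i i) - g i * S i i + (∑ k, r i k * S i k)
      - βH i * (Im i / Np i) * S i i = 0)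
    (heqb : ∀ i j, j ≠ i → g i * m j i * S i i - dH * S i j - r i j * S i j
      - βH j * (Im j / Np j) * S i j = 0)
    (heqc : ∀ i, -(dH + γH + g i) * I i i + (∑ k, r i k * I i k)
      + βH i * (Im i / Np i) * S i i = 0)
    (heqd : ∀ i j, j ≠ i → g i * m j i * I i i - (dH + γH + r i j) * I i j
      + βH j * (Im j / Np j) * S i j = 0)
    (heqe : ∀ i, γH * I i i - (dH + g i) * R i i + (∑ k, r i k * R i k) = 0)
    (heqf : ∀ i j, j ≠ i → g i * m j i * R i i + γH * I i j - (dH + r i j) * R i j = 0)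
    (heqg : ∀ i, sL * Lc i - dm * Sm i - βm i * (Sm i / Np i) * (∑ k, I k i) = 0)
    (heqh : ∀ i, βm i * (Sm i / Np i) * (∑ k, I k i) - dm * Im i = 0)
    (hSdiagpos : ∀ a, 0 < S a a)
    (hSmpos : ∀ a, 0 < Sm a)
    (i : Fin n) (hend : ∃ q, 0 < I q i) :
    0 < I i i := by
  obtain ⟨q, hq⟩ := hend
  have hsum : 0 < ∑ k, I k i :=
    Finset.sum_pos' (fun k _ => hInn k i) ⟨q, Finset.mem_univ q, hq⟩
  have h1 : 0 < βm i * (Sm i / Np i) * (∑ k, I k i) :=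
    mul_pos (mul_pos (hβm i) (div_pos (hSmpos i) (hNppos i))) hsum
  have h2 : 0 < dm * Im i := by linarith [heqh i]
  have hIm : 0 < Im i := pos_of_mul_pos_right h2 hdm.le
  have h3 : 0 < βH i * (Im i / Np i) * S i i :=
    mul_pos (mul_pos (hβH i) (div_pos hIm (hNppos i))) (hSdiagpos i)
  have h4 : 0 ≤ ∑ k, r i k * I i k :=
    Finset.sum_nonneg (fun k _ => mul_nonneg (hr i k) (hInn i k))
  have h5 : 0 < (dH + γH + g i) * I i i := by linarith [heqc i]
  exact pos_of_mul_pos_right h5 (by linarith [hg i])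
end

section
/- Suppose the metapopulation system is at equilibrium, that S_{ii} > 0 and Sm_i > 0 for all i, and that S_{ij} > 0 whenever g_i m_{ji} > 0. If the disease is endemic at node i (there exists q with I_{qi} > 0), then the disease is endemic at every node reachable from node i: for every j ∈ A_{i→} there exists k with I_{kj} > 0, and moreover I_{jj} > 0 for every such j. -/
theorem metapop_endemic_spreads_forward {n : ℕ} (hn : 1 ≤ n)
    (dH γH dm sL : ℝ) (hdH : 0 < dH) (hγH : 0 < γH) (hdm : 0 < dm) (hsL : 0 ≤ sL)
    (βH βm Lc g : Fin n → ℝ)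
    (hβH : ∀ i, 0 < βH i) (hβm : ∀ i, 0 < βm i)
    (hLc : ∀ i, 0 ≤ Lc i) (hg : ∀ i, 0 ≤ g i)
    (m r : Fin n → Fin n → ℝ)
    (hm : ∀ j i, 0 ≤ m j i) (hmii : ∀ i, m i i = 0)
    (hr : ∀ i j, 0 ≤ r i j) (hrii : ∀ i, r i i = 0)
    (S I R : Fin n → Fin n → ℝ) (Sm Im : Fin n → ℝ)
    (hSnn : ∀ i j, 0 ≤ S i j) (hInn : ∀ i j, 0 ≤ I i j) (hRnn : ∀ i j, 0 ≤ R i j)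
    (hSmnn : ∀ i, 0 ≤ Sm i) (hImnn : ∀ i, 0 ≤ Im i)
    (Np Nr : Fin n → ℝ)
    (hNp : ∀ i, Np i = ∑ j, (S j i + I j i + R j i))
    (hNr : ∀ i, Nr i = ∑ j, (S i j + I i j + R i j))
    (hNppos : ∀ i, 0 < Np i)
    (heqa : ∀ i, dH * (Nr i - S i i) - g i * S i i + (∑ k, r i k * S i k)
      - βH i * (Im i / Np i) * S i i = 0)
    (heqb : ∀ i j, j ≠ i → g i * m j i * S i i - dH * S i j - r i j * S i j
      - βH j * (Im j / Np j) * S i j = 0)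
    (heqc : ∀ i, -(dH + γH + g i) * I i i + (∑ k, r i k * I i k)
      + βH i * (Im i / Np i) * S i i = 0)
    (heqd : ∀ i j, j ≠ i → g i * m j i * I i i - (dH + γH + r i j) * I i j
      + βH j * (Im j / Np j) * S i j = 0)
    (heqe : ∀ i, γH * I i i - (dH + g i) * R i i + (∑ k, r i k * R i k) = 0)
    (heqf : ∀ i j, j ≠ i → g i * m j i * R i i + γH * I i j - (dH + r i j) * R i j = 0)
    (heqg : ∀ i, sL * Lc i - dm * Sm i - βm i * (Sm i / Np i) * (∑ k, I k i) = 0)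
    (heqh : ∀ i, βm i * (Sm i / Np i) * (∑ k, I k i) - dm * Im i = 0)
    (hSdiagpos : ∀ a, 0 < S a a)
    (hSmpos : ∀ a, 0 < Sm a)
    (hSpos : ∀ a b, 0 < g a * m b a → 0 < S a b)
    (i : Fin n) (hend : ∃ q, 0 < I q i) :
    ∀ j, Relation.ReflTransGen (fun a b => 0 < g a * m b a) i j →
      (∃ k, 0 < I k j) ∧ 0 < I j j := by
  have key : ∀ j, (∃ k, 0 < I k j) → 0 < I j j := by
    rintro j ⟨k, hk⟩
    have hsum : 0 < ∑ k, I k j :=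
      Finset.sum_pos' (fun a _ => hInn a j) ⟨k, Finset.mem_univ k, hk⟩
    have h1 : 0 < βm j * (Sm j / Np j) * (∑ k, I k j) :=
      mul_pos (mul_pos (hβm j) (div_pos (hSmpos j) (hNppos j))) hsum
    have hIm : 0 < Im j := by
      have h2 : 0 < dm * Im j := by linarith [heqh j]
      exact pos_of_mul_pos_right h2 hdm.le
    have h3 : 0 < βH j * (Im j / Np j) * S j j :=
      mul_pos (mul_pos (hβH j) (div_pos hIm (hNppos j))) (hSdiagpos j)
    have h4 : 0 ≤ ∑ k, r j k * I j k :=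
      Finset.sum_nonneg (fun k _ => mul_nonneg (hr j k) (hInn j k))
    have h5 : 0 < (dH + γH + g j) * I j j := by linarith [heqc j]
    exact pos_of_mul_pos_right h5 (by linarith [hg j])
  intro j hj
  have hmain : ∃ k, 0 < I k j := by
    induction hj with
    | refl => exact hend
    | @tail a b _ hab ih =>
      have haa := key a ih
      have hne : b ≠ a := by
        rintro rfl
        simp [hmii] at hab
      have h1 : 0 < g a * m b a * I a a := mul_pos hab haa
      have h2 : 0 ≤ βH b * (Im b / Np b) * S a b :=
        mul_nonneg (mul_nonneg (hβH b).le (div_nonneg (hImnn b) (hNppos b).le)) (hSnn a b)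
      have h3 : 0 < (dH + γH + r a b) * I a b := by linarith [heqd a b hne]
      exact ⟨a, pos_of_mul_pos_right h3 (by linarith [hr a b])⟩
  exact ⟨hmain, key j hmain⟩
end

section
/- Suppose the metapopulation system is at equilibrium, that S_{ii} > 0 and Sm_i > 0 for all i, that S_{ij} > 0 whenever g_i m_{ji} > 0, and that the outgoing travel matrix M^T = [g_i m_{ji}] is irreducible (for every pair of distinct nodes i, j there is a finite chain i = k_0, k_1, …, k_q = j with g_{k_t} m_{k_{t+1} k_t} > 0 for each t). If the disease is endemic at some node, then the disease is endemic at every node. -/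
theorem metapop_endemic_irreducible_all {n : ℕ} (hn : 1 ≤ n)
    (dH γH dm sL : ℝ) (hdH : 0 < dH) (hγH : 0 < γH) (hdm : 0 < dm) (hsL : 0 ≤ sL)
    (βH βm Lc g : Fin n → ℝ)
    (hβH : ∀ i, 0 < βH i) (hβm : ∀ i, 0 < βm i)
    (hLc : ∀ i, 0 ≤ Lc i) (hg : ∀ i, 0 ≤ g i)
    (m r : Fin n → Fin n → ℝ)
    (hm : ∀ j i, 0 ≤ m j i) (hmii : ∀ i, m i i = 0)
    (hr : ∀ i j, 0 ≤ r i j) (hrii : ∀ i, r i i = 0)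
    (S I R : Fin n → Fin n → ℝ) (Sm Im : Fin n → ℝ)
    (hSnn : ∀ i j, 0 ≤ S i j) (hInn : ∀ i j, 0 ≤ I i j) (hRnn : ∀ i j, 0 ≤ R i j)
    (hSmnn : ∀ i, 0 ≤ Sm i) (hImnn : ∀ i, 0 ≤ Im i)
    (Np Nr : Fin n → ℝ)
    (hNp : ∀ i, Np i = ∑ j, (S j i + I j i + R j i))
    (hNr : ∀ i, Nr i = ∑ j, (S i j + I i j + R i j))
    (hNppos : ∀ i, 0 < Np i)
    (heqa : ∀ i, dH * (Nr i - S i i) - g i * S i i + (∑ k, r i k * S i k)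
      - βH i * (Im i / Np i) * S i i = 0)
    (heqb : ∀ i j, j ≠ i → g i * m j i * S i i - dH * S i j - r i j * S i j
      - βH j * (Im j / Np j) * S i j = 0)
    (heqc : ∀ i, -(dH + γH + g i) * I i i + (∑ k, r i k * I i k)
      + βH i * (Im i / Np i) * S i i = 0)
    (heqd : ∀ i j, j ≠ i → g i * m j i * I i i - (dH + γH + r i j) * I i j
      + βH j * (Im j / Np j) * S i j = 0)
    (heqe : ∀ i, γH * I i i - (dH + g i) * R i i + (∑ k, r i k * R i k) = 0)
    (heqf : ∀ i j, j ≠ i → g i * m j i * R i i + γH * I i j - (dH + r i j) * R i j = 0)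
    (heqg : ∀ i, sL * Lc i - dm * Sm i - βm i * (Sm i / Np i) * (∑ k, I k i) = 0)
    (heqh : ∀ i, βm i * (Sm i / Np i) * (∑ k, I k i) - dm * Im i = 0)
    (hSdiagpos : ∀ a, 0 < S a a)
    (hSmpos : ∀ a, 0 < Sm a)
    (hSpos : ∀ a b, 0 < g a * m b a → 0 < S a b)
    (hirr : ∀ a b : Fin n, a ≠ b →
      Relation.TransGen (fun x y => 0 < g x * m y x) a b)
    (hend : ∃ i, ∃ k, 0 < I k i) :
    ∀ i : Fin n, ∃ k, 0 < I k i := by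
  have hdiag : ∀ i, (∃ k, 0 < I k i) → 0 < I i i := by
    rintro i ⟨k, hk⟩
    have hsum : 0 < ∑ k, I k i :=
      Finset.sum_pos' (fun k _ => hInn k i) ⟨k, Finset.mem_univ k, hk⟩
    have h1 : 0 < βm i * (Sm i / Np i) * (∑ k, I k i) :=
      mul_pos (mul_pos (hβm i) (div_pos (hSmpos i) (hNppos i))) hsum
    have h2 : 0 < dm * Im i := by linarith [heqh i]
    have h3 : 0 < Im i := pos_of_mul_pos_right h2 hdm.le
    have h4 : 0 < βH i * (Im i / Np i) * S i i :=
      mul_pos (mul_pos (hβH i) (div_pos h3 (hNppos i))) (hSdiagpos i)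
    have h5 : 0 ≤ ∑ k, r i k * I i k :=
      Finset.sum_nonneg fun k _ => mul_nonneg (hr i k) (hInn i k)
    have h6 : 0 < (dH + γH + g i) * I i i := by linarith [heqc i]
    exact pos_of_mul_pos_right h6 (by linarith [hg i])
  have hstep : ∀ i j, 0 < g i * m j i → (∃ k, 0 < I k i) → ∃ k, 0 < I k j := by
    intro i j hij hi
    have hne : j ≠ i := by
      rintro rfl
      simp [hmii] at hij
    have h1 : 0 < g i * m j i * I i i := mul_pos hij (hdiag i hi)
    have h2 : 0 ≤ βH j * (Im j / Np j) * S i j :=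
      mul_nonneg (mul_nonneg (hβH j).le (div_nonneg (hImnn j) (hNppos j).le)) (hSnn i j)
    have h3 : 0 < (dH + γH + r i j) * I i j := by linarith [heqd i j hne]
    exact ⟨i, pos_of_mul_pos_right h3 (by linarith [hr i j])⟩
  obtain ⟨a, ha⟩ := hend
  intro b
  by_cases hab : a = b
  · exact hab ▸ ha
  · have h := hirr a b hab
    induction h with
    | single h => exact hstep _ _ h ha
    | @tail c d _ h ih =>
      by_cases hac : a = c
      · exact hstep _ _ h (hac ▸ ha)
      · exact hstep _ _ h (ih hac)
end

section
/- Consider the mosquito population dynamics model with parameters b, s, s_L, d, d_L, d_m > 0 and carrying capacities K_E, K_L > 0, and let r = (b/(s+d))·(s/(s_L+d_L))·(s_L/d_m). If r > 1, then the system admits an equilibrium (E*, L*, A*) with all components positive, where L* = (1 − 1/r)·K_L/γ_L with γ_L = 1 + (s_L + d_L)K_L/(s K_E), A* = (s_L/d_m) L*, and E* = (s_L + d_L)L* / (s(1 − L*/K_L)); that is, these values satisfy b A*(1 − E*/K_E) − (s + d)E* = 0, s E*(1 − L*/K_L) − (s_L + d_L)L* = 0, and s_L L* − d_m A* = 0,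 and 0 < L* < K_L and 0 < E* < K_E. -/
theorem mosquito_endemic_equilibrium (b s sL d dL dm KE KL : ℝ)
    (hb : 0 < b) (hs : 0 < s) (hsL : 0 < sL) (hd : 0 < d) (hdL : 0 < dL) (hdm : 0 < dm)
    (hKE : 0 < KE) (hKL : 0 < KL)
    (r : ℝ) (hrdef : r = b / (s + d) * (s / (sL + dL)) * (sL / dm)) (hr1 : 1 < r)
    (γL : ℝ) (hγL : γL = 1 + (sL + dL) * KL / (s * KE))
    (Estar Lstar Astar : ℝ)
    (hLs : Lstar = (1 - 1 / r) * KL / γL)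
    (hAs : Astar = sL / dm * Lstar)
    (hEs : Estar = (sL + dL) * Lstar / (s * (1 - Lstar / KL))) :
    0 < Estar ∧ 0 < Lstar ∧ 0 < Astar ∧
    b * Astar * (1 - Estar / KE) - (s + d) * Estar = 0 ∧
    s * Estar * (1 - Lstar / KL) - (sL + dL) * Lstar = 0 ∧
    sL * Lstar - dm * Astar = 0 ∧
    Lstar < KL ∧ Estar < KE := by
  have hm : 0 < sL + dL := by linarith
  have hsd : 0 < s + d := by linarith
  have hr0 : 0 < r := by linarith
  have hR : b * sL * s = r * ((s + d) * (sL + dL) * dm) := by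
    rw [hrdef]; field_simp
  obtain ⟨c, hc⟩ : ∃ c, c = (sL + dL) * KL / (s * KE) := ⟨_, rfl⟩
  have hc0 : 0 < c := by rw [hc]; positivity
  have hcm : c * (s * KE) = (sL + dL) * KL := by rw [hc]; field_simp
  rw [← hc] at hγL
  have hγ0 : 0 < γL := by linarith
  have hri : 1 / r < 1 := by rw [div_lt_one hr0]; exact hr1
  have hri0 : 0 < 1 / r := by positivity
  obtain ⟨x, hx⟩ : ∃ x, x = (1 - 1 / r) / γL := ⟨_, rfl⟩
  have hx0 : 0 < x := by rw [hx]; exact div_pos (by linarith) hγ0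
  have hxγ : x * (1 + c) = 1 - 1 / r := by
    rw [← hγL, hx]; field_simp
  have hL : Lstar = x * KL := by rw [hLs, hx]; ring
  have hxL : Lstar / KL = x := by rw [hL]; field_simp
  have hcx : 0 < c * x := by positivity
  have hy : 0 < 1 - x := by linarith
  have hL0 : 0 < Lstar := by rw [hL]; positivity
  rw [hxL] at hEs ⊢
  have hE0 : 0 < Estar := by rw [hEs]; positivity
  have hE1 : s * Estar * (1 - x) = (sL + dL) * Lstar := by
    rw [hEs]; field_simp
  have hA0 : 0 < Astar := by rw [hAs]; positivity
  have hA1 : dm * Astar = sL * Lstar := by rw [hAs]; field_simp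
  have hEK : Estar * (1 - x) = c * x * KE := by
    apply mul_left_cancel₀ hs.ne'
    rw [hL] at hE1
    linear_combination hE1 - x * hcm
  have hEK2 : (1 - Estar / KE) * (1 - x) = 1 / r := by
    have : Estar / KE * (1 - x) = c * x := by
      rw [div_mul_eq_mul_div, hEK]; field_simp
    linear_combination -this - hxγ
  refine ⟨hE0, hL0, hA0, ?_, by linarith, by linarith, ?_, ?_⟩
  · have h1 : r * (1 / r) = 1 := by field_simp
    have hne : s * dm * (1 - x) ≠ 0 := by positivity
    apply mul_left_cancel₀ hne
    linear_combination b * Astar * s * dm * hEK2 - (s + d) * dm * hE1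
      + b * s * (1 / r) * hA1 + Lstar * (1 / r) * hR
      + Lstar * ((s + d) * (sL + dL) * dm) * h1
  · rw [hL]; nlinarith
  · have h2 : 0 < 1 - Estar / KE := by
      by_contra h
      push Not at h
      nlinarith
    have h3 : Estar / KE < 1 := by linarith
    rwa [div_lt_one hKE] at h3
end
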